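/- arXiv:1707.04226 — 2 statements merged into one kernel-verified Lean document; each statement's English description precedes it below -/
import Mathlib

section
/- If the affine fundamental form h of an immersed surface f : M → ℝ³ (endowed with a Birkhoff normal field η) has rank 2 at a point p ∈ M and is definite at p, then the tangent space T_pM admits a basis consisting of eigenvectors of the differential dη_p : T_pM → T_pM. -/
/-!
Differential geometry of immersed surfaces in three-dimensional normed
(Minkowski) spaces, following Balestro–Martini–Teixeira.

`E3 = ℝ³` carries its standard Euclidean inner product and, in addition, a
norm `N` which is strictly convex and smooth.  Surfaces are given in a local
parametrization `f : P2 → E3` (an immersion on an open set `U`), endowed with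
a Birkhoff normal field `η`.
-/

noncomputable section

open scoped InnerProductSpace

abbrev E3 := EuclideanSpace ℝ (Fin 3)
abbrev P2 := EuclideanSpace ℝ (Fin 2)

/-- A smooth, strictly convex norm on `ℝ³` (a Minkowski norm). -/
structure MinkowskiNorm3 where
  N : E3 → ℝ
  nonneg : ∀ x, 0 ≤ N x
  eq_zero_iff : ∀ x, N x = 0 ↔ x = 0
  smul_eq : ∀ (c : ℝ) (x : E3), N (c • x) = |c| * N x
  triangle : ∀ x y, N (x + y) ≤ N x + N y
  strict_triangle : ∀ x y : E3, LinearIndependent ℝ ![x, y] → N (x + y) < N x + N y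
  smooth : ContDiffOn ℝ (⊤ : ℕ∞) N {x : E3 | x ≠ 0}

namespace MinkowskiNorm3

/-- Birkhoff orthogonality of a vector `v` to a set (e.g. a plane) `H`:
`‖v + w‖ ≥ ‖v‖` for all `w ∈ H`. -/
def BirkhoffOrth (m : MinkowskiNorm3) (v : E3) (H : Set E3) : Prop :=
  ∀ w ∈ H, m.N v ≤ m.N (v + w)

/-- The (outward) Euclidean Gauss map of the unit sphere `∂B` of the norm,
expressed on ambient space as the normalized gradient of `N`.  Restricted to
`∂B` it is the map `u⁻¹ : ∂B → ∂B_e`, whose inverse is `u : ∂B_e → ∂B`. -/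
def sphereGauss (m : MinkowskiNorm3) (v : E3) : E3 :=
  ‖gradient m.N v‖⁻¹ • gradient m.N v

/-- The differential `du⁻¹` at a point `v ∈ ∂B`, applied to a vector `w`
(its restriction to the tangent plane of `∂B` at `v` is the inverse of
`du_{u⁻¹(v)}`). -/
def duInv (m : MinkowskiNorm3) (v w : E3) : E3 :=
  fderiv ℝ m.sphereGauss v w

/-- Admissibility of the norm: the unit sphere `∂B` has positive Euclidean
Gaussian curvature at every point; equivalently, the second fundamental form
of `∂B` with respect to the outward normal is positive definite, i.e.
`⟪du⁻¹ w, w⟫ > 0` for every nonzero vector `w` tangent to `∂B`. -/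
def Admissible (m : MinkowskiNorm3) : Prop :=
  ∀ v : E3, m.N v = 1 → ∀ w : E3, w ≠ 0 → fderiv ℝ m.N v w = 0 →
    0 < ⟪m.duInv v w, w⟫_ℝ

end MinkowskiNorm3

/-- An immersed surface (in a local parametrization on an open set `U ⊆ ℝ²`)
in the Minkowski space `(ℝ³, m)`, endowed with a Birkhoff normal vector
field `η`: a smooth unit field with `η(p) ⊣_B T_pM` for all `p`. -/
structure BSurface (m : MinkowskiNorm3) where
  U : Set P2
  isOpen : IsOpen U
  f : P2 → E3
  smooth_f : ContDiffOn ℝ (⊤ : ℕ∞) f U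
  immersion : ∀ p ∈ U, Function.Injective (fderiv ℝ f p)
  η : P2 → E3
  smooth_η : ContDiffOn ℝ (⊤ : ℕ∞) η U
  unit_η : ∀ p ∈ U, m.N (η p) = 1
  birkhoff : ∀ p ∈ U, m.BirkhoffOrth (η p) (Set.range (fderiv ℝ f p))

namespace BSurface

variable {m : MinkowskiNorm3}

/-- The tangent plane `T_pM`, identified (via the push-forward `df_p`) with a
linear plane in ambient `ℝ³`. -/
def tangent (S : BSurface m) (p : P2) : Set E3 := Set.range (fderiv ℝ S.f p)

/-- `h : P2 → P2 → ℝ` (in the parameter coordinates, i.e. `h v w` stands for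
`h(df_p v, df_p w)`) is the affine fundamental form of the immersion at `p`,
determined by the Gauss formula `D_X Y = ∇_X Y + h(X,Y) η`: for coordinate
directions `v, w`, the second derivative `D_v D_w f` minus `h v w • η p` is
tangential. -/
def IsAffineFundForm (S : BSurface m) (p : P2) (h : P2 → P2 → ℝ) : Prop :=
  ∀ v w : P2,
    fderiv ℝ (fun q => fderiv ℝ S.f q w) p v - h v w • S.η p ∈ S.tangent p

end BSurface

/-- The Minkowski normal curvature of the surface parametrized by `f` with
Birkhoff normal field `η`, at `p`, in the tangent direction `X = df_p v`:
`k_{M,p}(X) = ⟪du⁻¹_{η(p)} X, dη_p X⟫ / ⟪du⁻¹_{η(p)} X, X⟫`, using the natural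
identification of the parallel planes `T_pM ≅ T_{η(p)}∂B ≅ T_{ξ(p)}∂B_e`. -/
def normalCurv (m : MinkowskiNorm3) (f η : P2 → E3) (p v : P2) : ℝ :=
  ⟪m.duInv (η p) (fderiv ℝ f p v), fderiv ℝ η p v⟫_ℝ /
    ⟪m.duInv (η p) (fderiv ℝ f p v), fderiv ℝ f p v⟫_ℝ

/-- A symmetric endomorphism for a positive definite symmetric bilinear form has a basis of
eigenvectors. -/
theorem exists_eigenbasis_of_posDef {V : Type*} [AddCommGroup V] [Module ℝ V]
    [FiniteDimensional ℝ V] {n : ℕ} (hn : Module.finrank ℝ V = n)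
    (B : V →ₗ[ℝ] V →ₗ[ℝ] ℝ) (hsymm : ∀ v w, B v w = B w v) (hpos : ∀ v, v ≠ 0 → 0 < B v v)
    (A : V →ₗ[ℝ] V) (hA : ∀ v w, B (A v) w = B v (A w)) :
    ∃ (b : Module.Basis (Fin n) ℝ V) (μ : Fin n → ℝ), ∀ i, A (b i) = μ i • b i := by
  let core : InnerProductSpace.Core ℝ V :=
    { inner := fun v w => B v w
      conj_inner_symm := fun v w => by simpa using hsymm w v
      re_inner_nonneg := fun v => by
        rcases eq_or_ne v 0 with rfl | hv
        · simp
        · simpa using (hpos v hv).le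
      add_left := fun x y z => by simp
      smul_left := fun x y r => by simp
      definite := fun v hv => by
        by_contra hne
        exact (hpos v hne).ne' hv }
  let _ : NormedAddCommGroup V := core.toNormedAddCommGroup
  let _ : InnerProductSpace ℝ V := InnerProductSpace.ofCore core.toCore
  have hT : A.IsSymmetric := hA
  exact ⟨(hT.eigenvectorBasis hn).toBasis, hT.eigenvalues hn, fun i => by
    simp [hT.apply_eigenvectorBasis hn i]⟩

namespace MinkowskiNorm3

variable (m : MinkowskiNorm3)

theorem ne_zero_of_unit {x : E3} (hx : m.N x = 1) : x ≠ 0 := by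
  rintro rfl
  simp [(m.eq_zero_iff 0).2 rfl] at hx

theorem contDiffAt {x : E3} (hx : x ≠ 0) : ContDiffAt ℝ (⊤ : ℕ∞) m.N x :=
  m.smooth.contDiffAt (isOpen_ne.mem_nhds hx)

theorem hasFDerivAt {x : E3} (hx : x ≠ 0) : HasFDerivAt m.N (fderiv ℝ m.N x) x :=
  ((m.contDiffAt hx).differentiableAt (by simp)).hasFDerivAt

/-- Euler's identity for the norm. -/
theorem fderiv_apply_self {x : E3} (hx : x ≠ 0) : fderiv ℝ m.N x x = m.N x := by
  have h1 : HasDerivAt (fun t : ℝ => t • x) x 1 := by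
    simpa using (hasDerivAt_id (1 : ℝ)).smul_const x
  have h2 : HasDerivAt (fun t : ℝ => m.N (t • x)) (fderiv ℝ m.N x x) 1 :=
    HasFDerivAt.comp_hasDerivAt (l := m.N) (1 : ℝ) (by simpa using m.hasFDerivAt hx) h1
  have h3 : HasDerivAt (fun t : ℝ => t * m.N x) (m.N x) 1 := by
    simpa using (hasDerivAt_id (1 : ℝ)).mul_const (m.N x)
  refine h2.unique (h3.congr_of_eventuallyEq ?_)
  filter_upwards [lt_mem_nhds one_pos] with t ht
  rw [m.smul_eq, abs_of_pos ht]

theorem fderiv_eq_zero_of_birkhoffOrth {x : E3} (hx : x ≠ 0) {L : P2 →L[ℝ] E3}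
    (hL : m.BirkhoffOrth x (Set.range L)) (w : P2) : fderiv ℝ m.N x (L w) = 0 := by
  have h1 : HasFDerivAt (fun w => x + L w) L 0 := L.hasFDerivAt.const_add x
  have h2 : HasFDerivAt (fun w => m.N (x + L w)) ((fderiv ℝ m.N x).comp L) 0 :=
    HasFDerivAt.comp (g := m.N) (0 : P2) (by simpa using m.hasFDerivAt hx) h1
  have hmin : IsLocalMin (fun w => m.N (x + L w)) 0 :=
    Filter.Eventually.of_forall fun w => by simpa using hL (L w) ⟨w, rfl⟩
  exact DFunLike.congr_fun (hmin.hasFDerivAt_eq_zero h2) w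

end MinkowskiNorm3

namespace BSurface

variable {m : MinkowskiNorm3} (S : BSurface m) {p : P2}

theorem η_ne_zero (hp : p ∈ S.U) : S.η p ≠ 0 := m.ne_zero_of_unit (S.unit_η p hp)

theorem hasFDerivAt_η (hp : p ∈ S.U) : HasFDerivAt S.η (fderiv ℝ S.η p) p :=
  ((S.smooth_η.contDiffAt (S.isOpen.mem_nhds hp)).differentiableAt (by simp)).hasFDerivAt

theorem contDiffAt_f (hp : p ∈ S.U) : ContDiffAt ℝ (⊤ : ℕ∞) S.f p :=
  S.smooth_f.contDiffAt (S.isOpen.mem_nhds hp)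

theorem hasFDerivAt_fderiv_f (hp : p ∈ S.U) :
    HasFDerivAt (fderiv ℝ S.f) (fderiv ℝ (fderiv ℝ S.f) p) p :=
  (((S.contDiffAt_f hp).fderiv_right (m := 1) (by norm_cast)).differentiableAt
    (by simp)).hasFDerivAt

theorem conormal_apply_tangent (hp : p ∈ S.U) (w : P2) :
    fderiv ℝ m.N (S.η p) (fderiv ℝ S.f p w) = 0 :=
  m.fderiv_eq_zero_of_birkhoffOrth (S.η_ne_zero hp) (S.birkhoff p hp) w

theorem conormal_apply_fderiv_η (hp : p ∈ S.U) (v : P2) :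
    fderiv ℝ m.N (S.η p) (fderiv ℝ S.η p v) = 0 := by
  have h1 := (m.hasFDerivAt (S.η_ne_zero hp)).comp p (S.hasFDerivAt_η hp)
  have h2 : HasFDerivAt (m.N ∘ S.η) (0 : P2 →L[ℝ] ℝ) p :=
    (hasFDerivAt_const (1 : ℝ) p).congr_of_eventuallyEq
      (by filter_upwards [S.isOpen.mem_nhds hp] with q hq using S.unit_η q hq)
  exact DFunLike.congr_fun (h1.unique h2) v

theorem conormal_apply_η (hp : p ∈ S.U) : fderiv ℝ m.N (S.η p) (S.η p) = 1 := by
  rw [m.fderiv_apply_self (S.η_ne_zero hp), S.unit_η p hp]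

/-- The tangent plane is the kernel of the conormal. -/
theorem range_fderiv_f_eq_ker (hp : p ∈ S.U) :
    (fderiv ℝ S.f p : P2 →ₗ[ℝ] E3).range = (fderiv ℝ m.N (S.η p) : E3 →ₗ[ℝ] ℝ).ker := by
  refine Submodule.eq_of_le_of_finrank_eq ?_ ?_
  · rintro _ ⟨w, rfl⟩
    exact S.conormal_apply_tangent hp w
  · have hne : (fderiv ℝ m.N (S.η p) : E3 →ₗ[ℝ] ℝ) ≠ 0 := fun h0 => by
      have h1 := S.conormal_apply_η hp
      have h2 := DFunLike.congr_fun h0 (S.η p)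
      simp only [ContinuousLinearMap.coe_coe, LinearMap.zero_apply] at h2
      linarith
    have h1 := Module.Dual.finrank_ker_add_one_of_ne_zero hne
    rw [LinearMap.finrank_range_of_inj (S.immersion p hp)]
    simp only [finrank_euclideanSpace, Fintype.card_fin] at h1 ⊢
    omega

/-- The shape operator `dη_p`, read in the parameter plane. -/
theorem exists_shapeOperator (hp : p ∈ S.U) :
    ∃ A : P2 →ₗ[ℝ] P2, ∀ v, fderiv ℝ S.f p (A v) = fderiv ℝ S.η p v := by
  obtain ⟨L, hL⟩ := (fderiv ℝ S.f p : P2 →ₗ[ℝ] E3).exists_leftInverse_of_injective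
    (LinearMap.ker_eq_bot.2 (S.immersion p hp))
  refine ⟨L ∘ₗ (fderiv ℝ S.η p : P2 →ₗ[ℝ] E3), fun v => ?_⟩
  have hv : fderiv ℝ S.η p v ∈ (fderiv ℝ S.f p : P2 →ₗ[ℝ] E3).range := by
    rw [S.range_fderiv_f_eq_ker hp]
    exact S.conormal_apply_fderiv_η hp v
  obtain ⟨a, ha⟩ := hv
  have hLa : L (fderiv ℝ S.f p a) = a := DFunLike.congr_fun hL a
  change fderiv ℝ S.f p (L (fderiv ℝ S.η p v)) = _
  rw [← ha]
  exact congrArg _ hLa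

/-- The conormal component of the second derivative of the immersion. -/
def conormalForm (p : P2) : P2 →ₗ[ℝ] P2 →ₗ[ℝ] ℝ :=
  LinearMap.mk₂ ℝ (fun v w => fderiv ℝ m.N (S.η p) (fderiv ℝ (fderiv ℝ S.f) p v w))
    (by simp) (by simp) (by simp) (by simp)

theorem conormalForm_apply (p v w : P2) : S.conormalForm p v w =
    fderiv ℝ m.N (S.η p) (fderiv ℝ (fderiv ℝ S.f) p v w) := rfl

theorem conormalForm_comm (hp : p ∈ S.U) (v w : P2) :
    S.conormalForm p v w = S.conormalForm p w v := by
  rw [conormalForm_apply, conormalForm_apply,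
    ((S.contDiffAt_f hp).isSymmSndFDerivAt (by simp; norm_cast)).eq v w]

theorem IsAffineFundForm.eq_conormalForm {S : BSurface m} {h : P2 → P2 → ℝ}
    (hh : S.IsAffineFundForm p h) (hp : p ∈ S.U) (v w : P2) :
    h v w = S.conormalForm p v w := by
  obtain ⟨a, ha⟩ := hh v w
  have h1 := S.conormal_apply_tangent hp a
  have h2 : fderiv ℝ (fun q => fderiv ℝ S.f q w) p v = fderiv ℝ (fderiv ℝ S.f) p v w := by
    have h3 := (S.hasFDerivAt_fderiv_f hp).clm_apply (hasFDerivAt_const w p)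
    rw [h3.fderiv]
    simp
  rw [ha, h2, map_sub, map_smul, S.conormal_apply_η hp] at h1
  rw [conormalForm_apply]
  simp only [smul_eq_mul, mul_one] at h1
  linarith

/-- The Weingarten identity. -/
theorem conormalForm_eq_neg (hp : p ∈ S.U) (v w : P2) :
    S.conormalForm p v w =
      -fderiv ℝ (fderiv ℝ m.N) (S.η p) (fderiv ℝ S.η p v) (fderiv ℝ S.f p w) := by
  have hN : HasFDerivAt (fderiv ℝ m.N) (fderiv ℝ (fderiv ℝ m.N) (S.η p)) (S.η p) :=
    (((m.contDiffAt (S.η_ne_zero hp)).fderiv_right (m := 1) (by norm_cast)).differentiableAt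
      (by simp)).hasFDerivAt
  have h1 := (hN.comp p (S.hasFDerivAt_η hp)).clm_apply
    ((S.hasFDerivAt_fderiv_f hp).clm_apply (hasFDerivAt_const w p))
  have h2 : HasFDerivAt (fun q => fderiv ℝ m.N (S.η q) (fderiv ℝ S.f q w))
      (0 : P2 →L[ℝ] ℝ) p :=
    (hasFDerivAt_const (0 : ℝ) p).congr_of_eventuallyEq
      (by filter_upwards [S.isOpen.mem_nhds hp] with q hq using S.conormal_apply_tangent hq w)
  have h3 := DFunLike.congr_fun (h1.unique h2) v
  rw [conormalForm_apply]
  simp at h3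
  linarith

/-- The shape operator is symmetric for the conormal form. -/
theorem conormalForm_shapeOperator (hp : p ∈ S.U) {A : P2 →ₗ[ℝ] P2}
    (hA : ∀ v, fderiv ℝ S.f p (A v) = fderiv ℝ S.η p v) (v w : P2) :
    S.conormalForm p (A v) w = S.conormalForm p v (A w) := by
  rw [S.conormalForm_comm hp, S.conormalForm_eq_neg hp, S.conormalForm_eq_neg hp, hA, hA,
    ((m.contDiffAt (S.η_ne_zero hp)).isSymmSndFDerivAt (by simp; norm_cast)).eq]

end BSurface

/-- If the affine fundamental form `h` has rank `2` at `p` and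
is definite there, then `T_pM` admits a basis of eigenvectors of `dη_p`. -/
theorem rank_two_definite_diagonalizable (m : MinkowskiNorm3) (S : BSurface m)
    (p : P2) (hp : p ∈ S.U) (h : P2 → P2 → ℝ)
    (hh : S.IsAffineFundForm p h)
    (hdef : (∀ v : P2, v ≠ 0 → 0 < h v v) ∨ (∀ v : P2, v ≠ 0 → h v v < 0)) :
    ∃ v₁ v₂ : P2, LinearIndependent ℝ ![v₁, v₂] ∧
      ∃ μ₁ μ₂ : ℝ, fderiv ℝ S.η p v₁ = μ₁ • fderiv ℝ S.f p v₁ ∧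
        fderiv ℝ S.η p v₂ = μ₂ • fderiv ℝ S.f p v₂ := by
  obtain ⟨A, hA⟩ := S.exists_shapeOperator hp
  have hfin : Module.finrank ℝ P2 = 2 := by simp
  have hAsymm := S.conormalForm_shapeOperator hp hA
  obtain ⟨b, μ, hb⟩ : ∃ (b : Module.Basis (Fin 2) ℝ P2) (μ : Fin 2 → ℝ),
      ∀ i, A (b i) = μ i • b i := by
    simp only [hh.eq_conormalForm hp] at hdef
    rcases hdef with hpos | hneg
    · exact exists_eigenbasis_of_posDef hfin (S.conormalForm p) (S.conormalForm_comm hp) hpos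
        A hAsymm
    · exact exists_eigenbasis_of_posDef hfin (-S.conormalForm p)
        (fun v w => by simp [S.conormalForm_comm hp v w])
        (fun v hv => by simpa using hneg v hv) A (fun v w => by simp [hAsymm v w])
  refine ⟨b 0, b 1, ?_, μ 0, μ 1, ?_, ?_⟩
  · convert b.linearIndependent using 1
    ext i : 1
    fin_cases i <;> rfl
  · rw [← hA, hb, map_smul]
  · rw [← hA, hb, map_smul]
end
end

section
/- Assume ‖·‖ is an admissible norm on ℝ³ and let f : M → ℝ³ be an immersed surface with Birkhoff normal field η. If V ∈ T_pM is a principal direction at p ∈ M with associated principal curvature λ (i.e. dη_p(V) = λV, V ≠ 0), then the Minkowski normal curvature of M at p in the direction V equals λ: k_{M,p}(V) = λ. -/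
/-!
Differential geometry of immersed surfaces in three-dimensional normed
(Minkowski) spaces, following Balestro–Martini–Teixeira.

`E3 = ℝ³` carries its standard Euclidean inner product and, in addition, a
norm `N` which is strictly convex and smooth.  Surfaces are given in a local
parametrization `f : P2 → E3` (an immersion on an open set `U`), endowed with
a Birkhoff normal field `η`.
-/

noncomputable section

open scoped InnerProductSpace

namespace MinkowskiNorm3

variable {m : MinkowskiNorm3}

lemma BirkhoffOrth.fderiv_eq_zero {v w : E3} {H : Set E3} (h : m.BirkhoffOrth v H)
    (hw : ∀ t : ℝ, t • w ∈ H) : fderiv ℝ m.N v w = 0 := by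
  by_cases hd : DifferentiableAt ℝ m.N v
  · have hmin : IsLocalMin (fun t : ℝ => m.N (v + t • w)) 0 :=
      Filter.Eventually.of_forall fun t => by simpa using h (t • w) (hw t)
    exact hmin.hasDerivAt_eq_zero (hd.hasFDerivAt.hasLineDerivAt w)
  · simp [fderiv_zero_of_not_differentiableAt hd]

end MinkowskiNorm3

/-- If `V` is a principal direction at `p` with associated
principal curvature `λ`, then the Minkowski normal curvature of `M` at `p` in
the direction `V` equals `λ`. -/
theorem normal_curvature_principal (m : MinkowskiNorm3) (hadm : m.Admissible)
    (S : BSurface m) (p : P2) (hp : p ∈ S.U)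
    (lam : ℝ) (V : P2) (hV : V ≠ 0)
    (hE : fderiv ℝ S.η p V = lam • fderiv ℝ S.f p V) :
    normalCurv m S.f S.η p V = lam := by
  have hX : fderiv ℝ S.f p V ≠ 0 := fun h =>
    hV (S.immersion p hp (h.trans (map_zero _).symm))
  have htan : fderiv ℝ m.N (S.η p) (fderiv ℝ S.f p V) = 0 :=
    (S.birkhoff p hp).fderiv_eq_zero fun t => ⟨t • V, map_smul _ t V⟩
  have hpos := hadm (S.η p) (S.unit_η p hp) _ hX htan
  rw [normalCurv, hE, inner_smul_right, mul_div_cancel_right₀ _ hpos.ne']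
end
end
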